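/- Let i ∈ ℕ, let w ∈ {⊥,0,1}^i, let F ⊢ w be a fork, and let t be any tine of F. Let F̄ be the closure of F and let t̂ be the longest tine of F̄. Then length(t) ≤ length(t̂) + Reach(w). -/

import Mathlib

/-- The alphabet `{⊥, 0, 1}`: `none` is `⊥` (empty slot), `some false` is `0`
(special honest slot), `some true` is `1` (adversarial slot). -/
abbrev Trit : Type := Option Bool

/-- Depth of a vertex in a rooted tree given by a parent function, computed with
fuel (fuel `v` suffices since parents have smaller indices). -/
def depthAux (parent : ℕ → ℕ) : ℕ → ℕ → ℕ
  | 0, _ => 0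
  | fuel + 1, v => if v = 0 then 0 else depthAux parent fuel (parent v) + 1

/-- Depth of vertex `v` (number of edges from the root `0`). -/
def treeDepth (parent : ℕ → ℕ) (v : ℕ) : ℕ := depthAux parent v v

/-- A fork `F ⊢ w` with respect to a characteristic string `w ∈ {⊥,0,1}^i`
(positions `1, …, i`).  The vertices are `0, 1, …, m - 1`; vertex `0` is the root,
every other vertex has a parent of smaller index (edges directed away from the
root).  `label` is the labeling `ℓ`: the root has label `0`, every other vertex is
labeled by an index `j ∈ {1, …, i}` with `w[j] ≠ ⊥`; labels strictly increase along
directed paths; every index `j` with `w[j] = 0` is the label of exactly one vertex;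
and the depths of the vertices with such labels increase strictly with the label. -/
structure Fork (i : ℕ) (w : ℕ → Trit) : Type where
  m : ℕ
  m_pos : 0 < m
  parent : ℕ → ℕ
  label : ℕ → ℕ
  parent_root : parent 0 = 0
  parent_lt : ∀ v, 0 < v → v < m → parent v < v
  label_root : label 0 = 0
  label_valid : ∀ v, 0 < v → v < m → 1 ≤ label v ∧ label v ≤ i ∧ w (label v) ≠ none
  label_lt : ∀ v, 0 < v → v < m → label (parent v) < label v
  honest_unique : ∀ j, 1 ≤ j → j ≤ i → w j = some false →
    ∃! v, 0 < v ∧ v < m ∧ label v = j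
  honest_depth_mono : ∀ v₁ v₂, 0 < v₁ → v₁ < m → 0 < v₂ → v₂ < m →
    w (label v₁) = some false → w (label v₂) = some false →
    label v₁ < label v₂ → treeDepth parent v₁ < treeDepth parent v₂

namespace Fork

variable {i : ℕ} {w : ℕ → Trit}

/-- Depth of a vertex of the fork. A tine is a directed path from the root, so
tines are identified with their terminal vertices; the length of the tine ending at
`v` is `F.depth v`. -/
def depth (F : Fork i w) (v : ℕ) : ℕ := treeDepth F.parent v

/-- `u` is an ancestor of `v` (or `u = v`), i.e. `u` lies on the tine ending at `v`. -/
def Ancestor (F : Fork i w) (u v : ℕ) : Prop := ∃ k : ℕ, F.parent^[k] v = u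

/-- The tines ending at `v₁` and `v₂` are `s`-disjoint (`t₁ ≁ₛ t₂`): they share no
vertex whose label is `≥ s`. -/
def SDisjoint (F : Fork i w) (s v₁ v₂ : ℕ) : Prop :=
  ∀ u, F.Ancestor u v₁ → F.Ancestor u v₂ → F.label u < s

/-- `v` is a leaf of the fork. -/
def IsLeaf (F : Fork i w) (v : ℕ) : Prop := ∀ u, 0 < u → u < F.m → F.parent u ≠ v

/-- The fork is closed: every leaf has a label `j` with `w[j] = 0`. -/
def Closed (F : Fork i w) : Prop :=
  ∀ v, 0 < v → v < F.m → F.IsLeaf v → w (F.label v) = some false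

/-- The length of the longest tine of the fork. -/
noncomputable def maxDepth (F : Fork i w) : ℕ :=
  sSup {d : ℕ | ∃ v, v < F.m ∧ d = F.depth v}

/-- `reserve(t)` for the tine `t` ending at `v`: the number of indices `j > ℓ(t)`
with `w[j] = 1`. -/
def reserve (F : Fork i w) (v : ℕ) : ℕ :=
  ((Finset.Icc 1 i).filter fun j => F.label v < j ∧ w j = some true).card

/-- `reach(t) = reserve(t) - gap(t)` for the tine `t` ending at `v`, where
`gap(t)` is the length of the longest tine minus `length(t)`. -/
noncomputable def reach (F : Fork i w) (v : ℕ) : ℤ :=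
  (F.reserve v : ℤ) - ((F.maxDepth : ℤ) - (F.depth v : ℤ))

/-- `Reach(F, w)`: the largest reach attained by any tine of `F`. -/
noncomputable def reachFork (F : Fork i w) : ℤ :=
  sSup {z : ℤ | ∃ v, v < F.m ∧ z = F.reach v}

/-- `Margin_s(F, w)`: the maximum over pairs of `s`-disjoint tines `t₁ ≁ₛ t₂` of
`min{reach(t₁), reach(t₂)}`. -/
noncomputable def marginFork (F : Fork i w) (s : ℕ) : ℤ :=
  sSup {z : ℤ | ∃ v₁ v₂, v₁ < F.m ∧ v₂ < F.m ∧ F.SDisjoint s v₁ v₂ ∧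
    z = min (F.reach v₁) (F.reach v₂)}

/-- The tine ending at `v` is `l`-viable: for every index `j ≤ l` with `w[j] = 0`,
the depth of the (unique) vertex labeled `j` is at most the length of the tine.
A tine is viable iff it is `i`-viable. -/
def Viable (F : Fork i w) (l v : ℕ) : Prop :=
  ∀ j, 1 ≤ j → j ≤ l → w j = some false →
    ∀ u, 0 < u → u < F.m → F.label u = j → F.depth u ≤ F.depth v

/-- The fork is `(s, l)`-balanced: it contains two `l`-viable tines that are
`s`-disjoint.  It is `s`-balanced iff it is `(s, i)`-balanced. -/
def Balanced (F : Fork i w) (s l : ℕ) : Prop :=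
  ∃ v₁ v₂, v₁ < F.m ∧ v₂ < F.m ∧ F.Viable l v₁ ∧ F.Viable l v₂ ∧ F.SDisjoint s v₁ v₂

/-- The length of the longest tine of the closure `F̄` of `F` (the closure is
obtained by trimming all trailing adversarial vertices, so the length of its
longest tine is the maximum depth of an honest vertex or of the root). -/
noncomputable def closureMaxDepth (F : Fork i w) : ℕ :=
  sSup {d : ℕ | ∃ v, v < F.m ∧ (v = 0 ∨ w (F.label v) = some false) ∧ d = F.depth v}

end Fork

/-- `Reach(w)`: the maximum of `Reach(F, w)` over all closed forks `F ⊢ w`. -/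
noncomputable def ReachStr (i : ℕ) (w : ℕ → Trit) : ℤ :=
  sSup {z : ℤ | ∃ F : Fork i w, F.Closed ∧ z = F.reachFork}

/-- `Margin_s(w)`: the maximum of `Margin_s(F, w)` over all closed forks `F ⊢ w`. -/
noncomputable def MarginStr (i : ℕ) (w : ℕ → Trit) (s : ℕ) : ℤ :=
  sSup {z : ℤ | ∃ F : Fork i w, F.Closed ∧ z = F.marginFork s}

/-- `O_l(w)`: the string obtained from `w` by replacing every symbol `0` at a
position `> l` by `⊥`. -/
def Ol (l : ℕ) (w : ℕ → Trit) : ℕ → Trit :=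
  fun j => if l < j ∧ w j = some false then none else w j

theorem Nat.exists_count_eq_of_lt_count {p : ℕ → Prop} [DecidablePred p] {n k : ℕ}
    (h : k < Nat.count p n) : ∃ x < n, p x ∧ Nat.count p x = k := by
  induction n with
  | zero => simp at h
  | succ n ih =>
    by_cases hk : k < Nat.count p n
    · obtain ⟨x, hx, hp⟩ := ih hk
      exact ⟨x, hx.trans n.lt_succ_self, hp⟩
    · rw [Nat.count_succ] at h
      split_ifs at h with hp
      · exact ⟨n, n.lt_succ_self, hp, by lia⟩
      · lia

namespace Fork

variable {i : ℕ} {w : ℕ → Trit} (F : Fork i w)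

theorem depthAux_eq_depth {v fuel : ℕ} (hv : v < F.m) (h : v ≤ fuel) :
    depthAux F.parent fuel v = F.depth v := by
  induction v using Nat.strong_induction_on generalizing fuel with
  | _ v ih =>
    rcases Nat.eq_zero_or_pos v with rfl | hpos
    · cases fuel <;> simp [depth, treeDepth, depthAux]
    · have hlt := F.parent_lt v hpos hv
      obtain ⟨f, rfl⟩ : ∃ f, fuel = f + 1 := ⟨fuel - 1, by lia⟩
      obtain ⟨u, rfl⟩ : ∃ u, v = u + 1 := ⟨v - 1, by lia⟩
      simp only [depth, treeDepth, depthAux, Nat.add_one_ne_zero, if_false]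
      rw [ih _ hlt (hlt.trans hv) (by lia), ih _ hlt (hlt.trans hv) (by lia)]

@[simp]
theorem depth_zero : F.depth 0 = 0 := rfl

theorem depth_eq_depth_parent_add_one {v : ℕ} (hpos : 0 < v) (hv : v < F.m) :
    F.depth v = F.depth (F.parent v) + 1 := by
  have hlt := F.parent_lt v hpos hv
  obtain ⟨u, rfl⟩ : ∃ u, v = u + 1 := ⟨v - 1, by lia⟩
  rw [← F.depthAux_eq_depth (fuel := u) (hlt.trans hv) (by lia)]
  simp [depth, treeDepth, depthAux]

theorem parent_le {v : ℕ} (hv : v < F.m) : F.parent v ≤ v := by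
  rcases Nat.eq_zero_or_pos v with rfl | hpos
  · exact F.parent_root.le
  · exact (F.parent_lt v hpos hv).le

theorem depth_parent_le {v : ℕ} (hv : v < F.m) : F.depth (F.parent v) ≤ F.depth v := by
  rcases Nat.eq_zero_or_pos v with rfl | hpos
  · rw [F.parent_root]
  · exact (F.depth_eq_depth_parent_add_one hpos hv).symm ▸ Nat.le_succ _

theorem Ancestor.le {F : Fork i w} {u v : ℕ} (h : F.Ancestor u v) (hv : v < F.m) : u ≤ v := by
  obtain ⟨k, rfl⟩ := h
  induction k with
  | zero => rfl
  | succ k ih =>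
    rw [Function.iterate_succ_apply']
    exact (F.parent_le (ih.trans_lt hv)).trans ih

theorem Ancestor.depth_le {F : Fork i w} {u v : ℕ} (h : F.Ancestor u v) (hv : v < F.m) :
    F.depth u ≤ F.depth v := by
  obtain ⟨k, rfl⟩ := h
  induction k with
  | zero => rfl
  | succ k ih =>
    have hle : F.Ancestor (F.parent^[k] v) v := ⟨k, rfl⟩
    rw [Function.iterate_succ_apply']
    exact (F.depth_parent_le ((hle.le hv).trans_lt hv)).trans ih

theorem Ancestor.parent {F : Fork i w} {u v : ℕ} (h : F.Ancestor u v) :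
    F.Ancestor (F.parent u) v := by
  obtain ⟨k, rfl⟩ := h
  exact ⟨k + 1, Function.iterate_succ_apply' _ _ _⟩

theorem bddAbove_depth (p : ℕ → Prop) :
    BddAbove {d : ℕ | ∃ v, v < F.m ∧ p v ∧ d = F.depth v} := by
  refine (((Set.finite_lt_nat F.m).image F.depth).subset ?_).bddAbove
  rintro d ⟨v, hv, -, rfl⟩
  exact ⟨v, hv, rfl⟩

theorem depth_le_maxDepth {v : ℕ} (hv : v < F.m) : F.depth v ≤ F.maxDepth := by
  refine le_csSup ?_ ⟨v, hv, rfl⟩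
  simpa using F.bddAbove_depth fun _ => True

theorem depth_le_closureMaxDepth {v : ℕ} (hv : v < F.m)
    (h : v = 0 ∨ w (F.label v) = some false) : F.depth v ≤ F.closureMaxDepth :=
  le_csSup (F.bddAbove_depth _) ⟨v, hv, h, rfl⟩

theorem reserve_le (v : ℕ) : F.reserve v ≤ i :=
  (Finset.card_filter_le _ _).trans (by simp)

theorem reach_le {v : ℕ} (hv : v < F.m) : F.reach v ≤ i := by
  have := F.depth_le_maxDepth hv
  have := F.reserve_le v
  unfold reach
  lia

theorem reach_le_reachFork {v : ℕ} (hv : v < F.m) : F.reach v ≤ F.reachFork := by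
  refine le_csSup ⟨(i : ℤ), ?_⟩ ⟨v, hv, rfl⟩
  rintro z ⟨u, hu, rfl⟩
  exact F.reach_le hu

theorem reachFork_le : F.reachFork ≤ i := by
  refine csSup_le ⟨_, 0, F.m_pos, rfl⟩ ?_
  rintro z ⟨u, hu, rfl⟩
  exact F.reach_le hu

theorem reachFork_le_reachStr (h : F.Closed) : F.reachFork ≤ ReachStr i w := by
  refine le_csSup ⟨(i : ℤ), ?_⟩ ⟨F, h, rfl⟩
  rintro z ⟨G, -, rfl⟩
  exact G.reachFork_le

/-- The vertices of `F` that survive in its closure. -/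
def InClosure (u : ℕ) : Prop :=
  ∃ y, y < F.m ∧ (y = 0 ∨ w (F.label y) = some false) ∧ F.Ancestor u y

variable {F} in
theorem InClosure.lt {u : ℕ} (h : F.InClosure u) : u < F.m := by
  obtain ⟨y, hy, -, hu⟩ := h
  exact (hu.le hy).trans_lt hy

variable {F} in
theorem InClosure.parent {u : ℕ} (h : F.InClosure u) : F.InClosure (F.parent u) := by
  obtain ⟨y, hy, hh, hu⟩ := h
  exact ⟨y, hy, hh, hu.parent⟩

variable {F} in
theorem InClosure.depth_le {u : ℕ} (h : F.InClosure u) : F.depth u ≤ F.closureMaxDepth := by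
  obtain ⟨y, hy, hh, hu⟩ := h
  exact (hu.depth_le hy).trans (F.depth_le_closureMaxDepth hy hh)

theorem inClosure_of_honest {u : ℕ} (hu : u < F.m)
    (h : u = 0 ∨ w (F.label u) = some false) : F.InClosure u :=
  ⟨u, hu, h, 0, rfl⟩

theorem inClosure_zero : F.InClosure 0 := F.inClosure_of_honest F.m_pos (Or.inl rfl)

open scoped Classical in
/-- The position of a vertex of `F` among the vertices of its closure. -/
noncomputable def closureIndex (u : ℕ) : ℕ := Nat.count F.InClosure u

/-- The vertex of `F` at a given position among the vertices of its closure. -/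
noncomputable def closureVertex (k : ℕ) : ℕ := Nat.nth F.InClosure k

variable {F} in
@[simp]
theorem InClosure.closureVertex_closureIndex {u : ℕ} (h : F.InClosure u) :
    F.closureVertex (F.closureIndex u) = u := by
  classical
  exact Nat.nth_count h

variable {F} in
theorem InClosure.closureIndex_lt {u v : ℕ} (h : F.InClosure u) (huv : u < v) :
    F.closureIndex u < F.closureIndex v := by
  classical
  exact Nat.count_strict_mono h huv

@[simp]
theorem closureIndex_zero : F.closureIndex 0 = 0 := by
  classical
  exact Nat.count_zero _

@[simp]
theorem closureVertex_zero : F.closureVertex 0 = 0 := by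
  simpa using F.inClosure_zero.closureVertex_closureIndex

theorem exists_closureIndex_eq {k : ℕ} (h : k < F.closureIndex F.m) :
    ∃ x, F.InClosure x ∧ F.closureIndex x = k := by
  classical
  obtain ⟨x, -, hx⟩ := Nat.exists_count_eq_of_lt_count h
  exact ⟨x, hx⟩

theorem pos_of_closureIndex_pos {x : ℕ} (h : 0 < F.closureIndex x) : 0 < x := by
  rcases Nat.eq_zero_or_pos x with rfl | hx
  · simp at h
  · exact hx

variable {F} in
theorem InClosure.closureIndex_pos {x : ℕ} (hx : 0 < x) : 0 < F.closureIndex x := by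
  simpa using F.inClosure_zero.closureIndex_lt hx

/-- The parent function of the closure. -/
noncomputable def closureParent (k : ℕ) : ℕ := F.closureIndex (F.parent (F.closureVertex k))

theorem closureParent_lt {k : ℕ} (hk : 0 < k) (hkm : k < F.closureIndex F.m) :
    F.closureParent k < k := by
  obtain ⟨x, hx, rfl⟩ := F.exists_closureIndex_eq hkm
  simp only [closureParent, hx.closureVertex_closureIndex]
  exact hx.parent.closureIndex_lt (F.parent_lt x (F.pos_of_closureIndex_pos hk) hx.lt)

theorem depthAux_closureParent {x fuel : ℕ} (hx : F.InClosure x)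
    (h : F.closureIndex x ≤ fuel) :
    depthAux F.closureParent fuel (F.closureIndex x) = F.depth x := by
  induction fuel generalizing x with
  | zero =>
    rcases Nat.eq_zero_or_pos x with rfl | hpos
    · rfl
    · have := InClosure.closureIndex_pos (F := F) hpos
      lia
  | succ f ih =>
    rcases Nat.eq_zero_or_pos x with rfl | hpos
    · simp [depthAux]
    · have hlt := hx.parent.closureIndex_lt (F.parent_lt x hpos hx.lt)
      have hne : F.closureIndex x ≠ 0 := (InClosure.closureIndex_pos hpos).ne'
      have hp : F.closureParent (F.closureIndex x) = F.closureIndex (F.parent x) := by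
        simp [closureParent, hx]
      rw [depthAux, if_neg hne, hp, ih hx.parent (by lia),
        F.depth_eq_depth_parent_add_one hpos hx.lt]

theorem treeDepth_closureParent {x : ℕ} (hx : F.InClosure x) :
    treeDepth F.closureParent (F.closureIndex x) = F.depth x :=
  F.depthAux_closureParent hx le_rfl

/-- The closure of a fork, obtained by trimming all trailing adversarial vertices. -/
noncomputable def closure : Fork i w where
  m := F.closureIndex F.m
  m_pos := InClosure.closureIndex_pos F.m_pos
  parent := F.closureParent
  label k := F.label (F.closureVertex k)
  parent_root := by simp [closureParent, F.parent_root]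
  parent_lt _ := F.closureParent_lt
  label_root := by simp [F.label_root]
  label_valid k hk hkm := by
    obtain ⟨x, hx, rfl⟩ := F.exists_closureIndex_eq hkm
    simpa [hx] using F.label_valid x (F.pos_of_closureIndex_pos hk) hx.lt
  label_lt k hk hkm := by
    obtain ⟨x, hx, rfl⟩ := F.exists_closureIndex_eq hkm
    simpa [closureParent, hx, hx.parent] using
      F.label_lt x (F.pos_of_closureIndex_pos hk) hx.lt
  honest_unique j hj hji hw := by
    obtain ⟨x, ⟨hpos, hxm, rfl⟩, huniq⟩ := F.honest_unique j hj hji hw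
    have hx := F.inClosure_of_honest hxm (Or.inr hw)
    refine ⟨F.closureIndex x, ⟨InClosure.closureIndex_pos hpos, hx.closureIndex_lt hxm,
      by simp [hx]⟩, ?_⟩
    rintro k ⟨hk, hkm, hkl⟩
    obtain ⟨y, hy, rfl⟩ := F.exists_closureIndex_eq hkm
    rw [hy.closureVertex_closureIndex] at hkl
    rw [huniq y ⟨F.pos_of_closureIndex_pos hk, hy.lt, hkl⟩]
  honest_depth_mono k₁ k₂ hk₁ hkm₁ hk₂ hkm₂ := by
    obtain ⟨x, hx, rfl⟩ := F.exists_closureIndex_eq hkm₁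
    obtain ⟨y, hy, rfl⟩ := F.exists_closureIndex_eq hkm₂
    rw [F.treeDepth_closureParent hx, F.treeDepth_closureParent hy,
      hx.closureVertex_closureIndex, hy.closureVertex_closureIndex]
    exact F.honest_depth_mono x y (F.pos_of_closureIndex_pos hk₁) hx.lt
      (F.pos_of_closureIndex_pos hk₂) hy.lt

theorem closed_closure : F.closure.Closed := by
  intro k hk hkm hleaf
  obtain ⟨x, hx, rfl⟩ := F.exists_closureIndex_eq hkm
  have hpos := F.pos_of_closureIndex_pos hk
  change w (F.label (F.closureVertex (F.closureIndex x))) = some false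
  rw [hx.closureVertex_closureIndex]
  obtain ⟨y, hy, hh, n, hn⟩ := hx
  cases n with
  | zero =>
    obtain rfl : y = x := hn
    exact hh.resolve_left hpos.ne'
  | succ n =>
    rw [Function.iterate_succ_apply'] at hn
    have hz : F.InClosure (F.parent^[n] y) := ⟨y, hy, hh, n, rfl⟩
    have hzpos : 0 < F.parent^[n] y := by
      refine Nat.pos_of_ne_zero fun h0 => ?_
      rw [h0, F.parent_root] at hn
      lia
    refine absurd ?_ (hleaf _ (InClosure.closureIndex_pos hzpos) (hz.closureIndex_lt hz.lt))
    simp [closure, closureParent, hz, hn]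

theorem depth_closure {x : ℕ} (hx : F.InClosure x) :
    F.closure.depth (F.closureIndex x) = F.depth x :=
  F.treeDepth_closureParent hx

theorem reserve_closure {x : ℕ} (hx : F.InClosure x) :
    F.closure.reserve (F.closureIndex x) = F.reserve x := by
  simp [reserve, closure, hx]

theorem maxDepth_closure_le : F.closure.maxDepth ≤ F.closureMaxDepth := by
  refine csSup_le ⟨_, 0, F.closure.m_pos, rfl⟩ ?_
  rintro d ⟨k, hk, rfl⟩
  obtain ⟨x, hx, rfl⟩ := F.exists_closureIndex_eq hk
  rw [F.depth_closure hx]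
  exact hx.depth_le

/-- Below its last honest vertex, a tine only uses adversarial labels, each at most once. -/
theorem exists_honest_depth_le {v : ℕ} (hv : v < F.m) :
    ∃ u, u < F.m ∧ (u = 0 ∨ w (F.label u) = some false) ∧
      F.label u ≤ F.label v ∧ F.depth v ≤ F.depth u + ((Finset.Icc 1 i).filter fun j =>
        (F.label u < j ∧ w j = some true) ∧ j ≤ F.label v).card := by
  induction v using Nat.strong_induction_on with
  | _ v ih =>
    by_cases hh : v = 0 ∨ w (F.label v) = some false
    · exact ⟨v, hv, hh, le_rfl, Nat.le_add_right _ _⟩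
    · push Not at hh
      have hpos := Nat.pos_of_ne_zero hh.1
      have hlt := F.parent_lt v hpos hv
      obtain ⟨u, hu, huh, hul, hd⟩ := ih _ hlt (hlt.trans hv)
      obtain ⟨h1, hi, hne⟩ := F.label_valid v hpos hv
      have hadv : w (F.label v) = some true := by
        rcases hwv : w (F.label v) with _ | _ | _ <;> simp_all
      have hl := F.label_lt v hpos hv
      have hul' : F.label u < F.label v := hul.trans_lt hl
      refine ⟨u, hu, huh, hul'.le, ?_⟩
      rw [F.depth_eq_depth_parent_add_one hpos hv]
      have hss : ((Finset.Icc 1 i).filter fun j =>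
          (F.label u < j ∧ w j = some true) ∧ j ≤ F.label (F.parent v)) ⊂
          (Finset.Icc 1 i).filter fun j =>
            (F.label u < j ∧ w j = some true) ∧ j ≤ F.label v := by
        refine Finset.ssubset_iff_subset_ne.2 ⟨fun j hj => ?_, fun he => ?_⟩
        · simp only [Finset.mem_filter] at hj ⊢
          exact ⟨hj.1, hj.2.1, hj.2.2.trans hl.le⟩
        · have : F.label v ∈ (Finset.Icc 1 i).filter fun j =>
              (F.label u < j ∧ w j = some true) ∧ j ≤ F.label (F.parent v) := by
            rw [he]
            simp [h1, hi, hul', hadv]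
          simp only [Finset.mem_filter] at this
          lia
      have := Finset.card_lt_card hss
      lia

end Fork

/-- For any fork `F ⊢ w` and any tine `t` of `F` (the tine ending at vertex `v`),
`length(t) ≤ length(t̂) + Reach(w)`, where `t̂` is the longest tine of the closure
`F̄` of `F`. -/
theorem stmt_17 (i : ℕ) (w : ℕ → Trit) (F : Fork i w) (v : ℕ) (hv : v < F.m) :
    (F.depth v : ℤ) ≤ (F.closureMaxDepth : ℤ) + ReachStr i w := by
  obtain ⟨u, hu, hh, -, hd⟩ := F.exists_honest_depth_le hv
  have hc := F.inClosure_of_honest hu hh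
  have hr := F.closure.reach_le_reachFork (hc.closureIndex_lt hu)
  have hs := F.closure.reachFork_le_reachStr F.closed_closure
  have hm := F.maxDepth_closure_le
  rw [Fork.reach, F.reserve_closure hc, F.depth_closure hc] at hr
  have hle : ((Finset.Icc 1 i).filter fun j =>
      (F.label u < j ∧ w j = some true) ∧ j ≤ F.label v).card ≤ F.reserve u :=
    Finset.card_le_card fun j hj => by
      simp only [Finset.mem_filter] at hj ⊢
      exact ⟨hj.1, hj.2.1⟩
  lia
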